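/- For every α ∈ {x, y, z} and every polynomial f with real coefficients, lim_{N→∞} 2^{-N} tr f(Ŝ_α^{(N)}/√N) = √(2/π) ∫_{-∞}^{∞} f(η) e^{-2η²} dη, where f(Ŝ_α^{(N)}/√N) denotes the matrix obtained by substituting the matrix Ŝ_α^{(N)}/√N into the polynomial f. -/

import Mathlib

open Matrix Filter Topology MeasureTheory

/-- The spin-1/2 matrices: `spinMat 0 = s_x`, `spinMat 1 = s_y`, `spinMat 2 = s_z`. -/
noncomputable def spinMat : Fin 3 → Matrix (Fin 2) (Fin 2) ℂ
  | 0 => !![0, 1/2; 1/2, 0]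
  | 1 => !![0, -Complex.I/2; Complex.I/2, 0]
  | 2 => !![1/2, 0; 0, -1/2]

/-- The `N`-fold Kronecker (tensor) product of `2 × 2` matrices, realized on the
index type `Fin N → Fin 2` of cardinality `2^N`. -/
noncomputable def kronPow (N : ℕ) (A : Fin N → Matrix (Fin 2) (Fin 2) ℂ) :
    Matrix (Fin N → Fin 2) (Fin N → Fin 2) ℂ :=
  Matrix.of fun f g => ∏ k, A k (f k) (g k)

/-- The total spin operator `Ŝ_α^{(N)} = Σ_{j=1}^N I₂^{⊗(j-1)} ⊗ s_α ⊗ I₂^{⊗(N-j)}`. -/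
noncomputable def totalSpin (N : ℕ) (α : Fin 3) :
    Matrix (Fin N → Fin 2) (Fin N → Fin 2) ℂ :=
  ∑ j : Fin N, kronPow N (fun k => if k = j then spinMat α else 1)

noncomputable def sg (i : Fin 2) : ℝ := if i = 0 then 1/2 else -1/2

noncomputable def dsum (N : ℕ) (x : Fin N → Fin 2) : ℝ := ∑ j, sg (x j)

noncomputable def mom (N p : ℕ) : ℝ := (∑ x : Fin N → Fin 2, dsum N x ^ p) / 2 ^ N

noncomputable def gint (p : ℕ) : ℝ := ∫ η : ℝ, η ^ p * Real.exp (-2 * η ^ 2)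

theorem gint_integrable (p : ℕ) : Integrable (fun η : ℝ => η ^ p * Real.exp (-2 * η ^ 2)) := by
  have h := integrable_rpow_mul_exp_neg_mul_sq (b := 2) (by norm_num) (s := (p : ℝ))
    (by have : (0 : ℝ) ≤ p := Nat.cast_nonneg p
        linarith)
  simpa using h

theorem gint_zero : Real.sqrt (2 / Real.pi) * gint 0 = 1 := by
  unfold gint
  have := integral_gaussian 2
  simp only [pow_zero, one_mul]
  rw [this, ← Real.sqrt_mul (by positivity)]
  rw [show (2 / Real.pi * (Real.pi / 2)) = 1 by field_simp]
  simp

theorem gint_parts (p : ℕ) : (p : ℝ) * gint (p - 1) = 4 * gint (p + 1) := by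
  have hd : ∀ η : ℝ, HasDerivAt (fun η : ℝ => η ^ p * Real.exp (-2 * η ^ 2))
      ((p : ℝ) * (η ^ (p - 1) * Real.exp (-2 * η ^ 2))
        - 4 * (η ^ (p + 1) * Real.exp (-2 * η ^ 2))) η := by
    intro η
    have h1 := hasDerivAt_pow p η
    have h2 : HasDerivAt (fun η : ℝ => Real.exp (-2 * η ^ 2))
        (Real.exp (-2 * η ^ 2) * (-2 * ((2 : ℕ) * η ^ (2 - 1)))) η :=
      ((hasDerivAt_pow 2 η).const_mul (-2)).exp
    refine (h1.mul h2).congr_deriv ?_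
    norm_num
    ring
  have hi1 := (gint_integrable (p - 1)).const_mul (p : ℝ)
  have hi2 := (gint_integrable (p + 1)).const_mul (4 : ℝ)
  have := integral_eq_zero_of_hasDerivAt_of_integrable hd (hi1.sub hi2) (gint_integrable p)
  rw [integral_sub hi1 hi2, integral_const_mul, integral_const_mul] at this
  unfold gint
  linarith

theorem mom_zero (N : ℕ) : mom N 0 = 1 := by
  simp [mom]

theorem mom_site (N p : ℕ) (j : Fin (N + 1)) :
    ∑ x : Fin (N + 1) → Fin 2, sg (x j) * dsum (N + 1) x ^ p
      = ∑ y : Fin N → Fin 2,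
        (1/2) * ((dsum N y + 1/2) ^ p - (dsum N y + (-1/2)) ^ p) := by
  rw [← (Fin.insertNthEquiv (fun _ => Fin 2) j).sum_comp, Fintype.sum_prod_type,
    Fin.sum_univ_two, ← Finset.sum_add_distrib]
  refine Finset.sum_congr rfl fun y _ => ?_
  simp only [dsum, Fin.sum_univ_succAbove _ j, Fin.insertNthEquiv_apply, Fin.insertNth_apply_same,
    Fin.insertNth_apply_succAbove]
  simp [sg]
  ring

theorem mom_rec (N p : ℕ) : mom (N + 1) (p + 1) =
    ((N : ℝ) + 1) / 4 * ∑ k ∈ Finset.range (p + 1),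
      (((1/2) ^ k - (-1/2) ^ k) * (p.choose k : ℝ)) * mom N (p - k) := by
  have h1 : ∑ x : Fin (N + 1) → Fin 2, dsum (N + 1) x ^ (p + 1)
      = ((N : ℝ) + 1) * ∑ y : Fin N → Fin 2,
        (1/2) * ((dsum N y + 1/2) ^ p - (dsum N y + (-1/2)) ^ p) := by
    calc _ = ∑ x : Fin (N + 1) → Fin 2, ∑ j, sg (x j) * dsum (N + 1) x ^ p := by
          refine Finset.sum_congr rfl fun x _ => ?_
          rw [← Finset.sum_mul, pow_succ', ← dsum]
      _ = _ := by
          rw [Finset.sum_comm, Finset.sum_congr rfl fun j _ => mom_site N p j]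
          simp
  have h2 : ∀ t : ℝ, (t + 1/2) ^ p - (t + (-1/2)) ^ p = ∑ k ∈ Finset.range (p + 1),
      (((1/2) ^ k - (-1/2) ^ k) * (p.choose k : ℝ)) * t ^ (p - k) := by
    intro t
    rw [add_comm t, add_comm t, add_pow, add_pow, ← Finset.sum_sub_distrib]
    refine Finset.sum_congr rfl fun k _ => ?_
    ring
  unfold mom
  rw [h1, ← Finset.mul_sum, Finset.sum_congr rfl fun y _ => h2 _, Finset.sum_comm]
  simp only [← Finset.mul_sum, mul_div_assoc', ← Finset.sum_div]
  rw [pow_succ]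
  field_simp
  ring

theorem mom_lim (p : ℕ) : Tendsto (fun N : ℕ => mom N p / Real.sqrt N ^ p) atTop
    (𝓝 (Real.sqrt (2 / Real.pi) * gint p)) := by
  induction p using Nat.strong_induction_on with
  | _ p ih =>
  rcases p with _ | p
  · rw [gint_zero]
    simp [mom_zero]
  rw [← tendsto_add_atTop_iff_nat 1]
  have hs1 : Tendsto (fun N : ℕ => 1 / Real.sqrt ((N : ℝ) + 1)) atTop (𝓝 0) := by
    have := (tendsto_one_div_add_atTop_nhds_zero_nat (𝕜 := ℝ)).sqrt
    simpa using this
  have hs2 : Tendsto (fun N : ℕ => Real.sqrt N / Real.sqrt ((N : ℝ) + 1)) atTop (𝓝 1) := by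
    have := (tendsto_natCast_div_add_atTop (1 : ℝ)).sqrt
    simpa using this
  have hterm : ∀ k ∈ Finset.range (p + 1), Tendsto (fun N : ℕ =>
      (((1/2) ^ k - (-1/2) ^ k) * (p.choose k : ℝ)) *
        ((mom N (p - k) / Real.sqrt N ^ (p - k)) *
          ((Real.sqrt N / Real.sqrt ((N : ℝ) + 1)) ^ (p - k)
            * (1 / Real.sqrt ((N : ℝ) + 1)) ^ (k - 1)))) atTop
      (𝓝 ((((1/2) ^ k - (-1/2) ^ k) * (p.choose k : ℝ)) *
        ((Real.sqrt (2 / Real.pi) * gint (p - k)) * (1 ^ (p - k) * 0 ^ (k - 1))))) := by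
    intro k hk
    exact ((ih (p - k) (by omega)).mul ((hs2.pow _).mul (hs1.pow _))).const_mul _
  have hsum := (tendsto_finsetSum _ hterm).const_mul (1/4 : ℝ)
  have hlim : (1/4 : ℝ) * ∑ k ∈ Finset.range (p + 1),
      ((((1/2) ^ k - (-1/2) ^ k) * (p.choose k : ℝ)) *
        ((Real.sqrt (2 / Real.pi) * gint (p - k)) * (1 ^ (p - k) * 0 ^ (k - 1))))
      = Real.sqrt (2 / Real.pi) * gint (p + 1) := by
    have hp := gint_parts p
    have : ∑ k ∈ Finset.range (p + 1),
      ((((1/2) ^ k - (-1/2) ^ k) * (p.choose k : ℝ)) *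
        ((Real.sqrt (2 / Real.pi) * gint (p - k)) * (1 ^ (p - k) * 0 ^ (k - 1))))
        = (p : ℝ) * (Real.sqrt (2 / Real.pi) * gint (p - 1)) := by
      rw [Finset.sum_eq_single 1]
      · norm_num
      · intro k _ hk1
        rcases k with _ | _ | k
        · simp
        · simp at hk1
        · simp
      · intro h
        have : p = 0 := by simpa using h
        subst this
        simp
    rw [this]
    linear_combination (1/4 : ℝ) * Real.sqrt (2 / Real.pi) * hp
  rw [hlim] at hsum
  refine hsum.congr' ?_
  filter_upwards [eventually_ge_atTop 1] with N hN
  have hN0 : 0 < Real.sqrt N := Real.sqrt_pos.mpr (by exact_mod_cast hN)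
  have hN1 : 0 < Real.sqrt ((N : ℝ) + 1) := Real.sqrt_pos.mpr (by positivity)
  have hsq : Real.sqrt ((N : ℝ) + 1) ^ 2 = N + 1 := Real.sq_sqrt (by positivity)
  push_cast
  rw [mom_rec]
  generalize Real.sqrt ((N : ℝ) + 1) = b at *
  generalize Real.sqrt (N : ℝ) = a at *
  rw [Finset.mul_sum, Finset.mul_sum, Finset.sum_div]
  refine Finset.sum_congr rfl fun k hk => ?_
  rcases k with _ | k
  · simp
  have hk' : k + 1 ≤ p := by simpa [Nat.lt_succ_iff] using hk
  obtain ⟨q, rfl⟩ := Nat.exists_eq_add_of_le hk'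
  simp only [Nat.add_sub_cancel_left, Nat.add_sub_cancel]
  have : b ^ (k + 1 + q + 1) = b ^ 2 * b ^ q * b ^ k := by ring
  rw [this, div_pow a b, div_pow 1 b, one_pow, ← hsq]
  field_simp

theorem real_lim (f : Polynomial ℝ) : Tendsto (fun N : ℕ =>
      (∑ x : Fin N → Fin 2, f.eval ((Real.sqrt N)⁻¹ * dsum N x)) / 2 ^ N) atTop
      (𝓝 (Real.sqrt (2 / Real.pi) * ∫ η : ℝ, f.eval η * Real.exp (-2 * η ^ 2))) := by
  have key : Integrable (fun η : ℝ => f.eval η * Real.exp (-2 * η ^ 2)) ∧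
    Tendsto (fun N : ℕ =>
      (∑ x : Fin N → Fin 2, f.eval ((Real.sqrt N)⁻¹ * dsum N x)) / 2 ^ N) atTop
      (𝓝 (Real.sqrt (2 / Real.pi) * ∫ η : ℝ, f.eval η * Real.exp (-2 * η ^ 2))) := by
    induction f using Polynomial.induction_on' with
    | add f g hf hg =>
      simp only [Polynomial.eval_add, add_mul]
      refine ⟨hf.1.add hg.1, ?_⟩
      rw [integral_add hf.1 hg.1, mul_add]
      simp only [Finset.sum_add_distrib, add_div]
      exact hf.2.add hg.2
    | monomial n a =>
      simp only [Polynomial.eval_monomial, mul_assoc]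
      refine ⟨(gint_integrable n).const_mul a, ?_⟩
      rw [integral_const_mul, mul_left_comm]
      refine ((mom_lim n).const_mul a).congr fun N => ?_
      simp only [mom, mul_pow, ← Finset.mul_sum, inv_pow]
      ring
  exact key.2

theorem kronPow_mul (N : ℕ) (A B : Fin N → Matrix (Fin 2) (Fin 2) ℂ) :
    kronPow N A * kronPow N B = kronPow N (fun k => A k * B k) := by
  ext f g
  simp only [kronPow, Matrix.mul_apply, Matrix.of_apply, Finset.prod_univ_sum,
    Fintype.piFinset_univ, Finset.prod_mul_distrib]

theorem kronPow_one (N : ℕ) : kronPow N (fun _ => 1) = 1 := by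
  ext f g
  simp only [kronPow, Matrix.of_apply, Matrix.one_apply, Finset.prod_boole, funext_iff]
  simp

theorem spin_conj (α : Fin 3) : ∃ U V : Matrix (Fin 2) (Fin 2) ℂ,
    U * V = 1 ∧ V * U = 1 ∧ spinMat α = U * spinMat 2 * V := by
  fin_cases α
  · refine ⟨!![1, 1; 1, -1], !![1/2, 1/2; 1/2, -1/2], ?_, ?_, ?_⟩ <;>
    · ext i j
      fin_cases i <;> fin_cases j <;> simp [spinMat] <;> norm_num
  · refine ⟨!![1, 1; Complex.I, -Complex.I], !![1/2, -Complex.I/2; 1/2, Complex.I/2],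
      ?_, ?_, ?_⟩ <;>
    · ext i j
      fin_cases i <;> fin_cases j <;> simp [spinMat] <;> ring_nf <;> simp <;> norm_num
  · exact ⟨1, 1, by simp, by simp, by simp⟩

theorem totalSpin_conj (N : ℕ) (α : Fin 3) : ∃ U V : Matrix (Fin N → Fin 2) (Fin N → Fin 2) ℂ,
    U * V = 1 ∧ V * U = 1 ∧ totalSpin N α = U * totalSpin N 2 * V := by
  obtain ⟨U, V, h1, h2, h3⟩ := spin_conj α
  refine ⟨kronPow N fun _ => U, kronPow N fun _ => V, ?_, ?_, ?_⟩
  · rw [kronPow_mul, h1, kronPow_one]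
  · rw [kronPow_mul, h2, kronPow_one]
  · unfold totalSpin
    rw [Finset.mul_sum, Finset.sum_mul]
    refine Finset.sum_congr rfl fun j _ => ?_
    rw [kronPow_mul, kronPow_mul]
    congr 1
    funext k
    split_ifs
    · exact h3
    · simp [h1]

theorem totalSpin_two (N : ℕ) :
    totalSpin N 2 = Matrix.diagonal fun x => ((dsum N x : ℝ) : ℂ) := by
  have hz : spinMat 2 = Matrix.diagonal fun i => ((sg i : ℝ) : ℂ) := by
    ext i j
    fin_cases i <;> fin_cases j <;> simp [spinMat, sg]
  have hk : ∀ j : Fin N, kronPow N (fun k => if k = j then spinMat 2 else 1)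
      = Matrix.diagonal fun x => ((sg (x j) : ℝ) : ℂ) := by
    intro j
    ext f g
    rw [kronPow, Matrix.of_apply, Matrix.diagonal_apply]
    split_ifs with h
    · subst h
      rw [Finset.prod_eq_single j]
      · simp [hz]
      · intro b _ hb
        simp [hb]
      · simp
    · obtain ⟨k, hk⟩ := Function.ne_iff.mp h
      refine Finset.prod_eq_zero (Finset.mem_univ k) ?_
      split_ifs <;> simp [hz, hk]
  unfold totalSpin
  rw [Finset.sum_congr rfl fun j _ => hk j]
  ext f g
  simp only [Matrix.sum_apply, Matrix.diagonal_apply, dsum]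
  split_ifs <;> simp

theorem trace_formula (N : ℕ) (α : Fin 3) (c : ℝ) (f : Polynomial ℝ) :
    (Polynomial.aeval ((c : ℂ) • totalSpin N α) f).trace
      = ((∑ x : Fin N → Fin 2, f.eval (c * dsum N x) : ℝ) : ℂ) := by
  obtain ⟨U, V, h1, h2, h3⟩ := totalSpin_conj N α
  have hpow : ∀ n : ℕ, ((c : ℂ) • totalSpin N α) ^ n
      = U * (Matrix.diagonal fun x => (((c * dsum N x) ^ n : ℝ) : ℂ)) * V := by
    intro n
    induction n with
    | zero => simp [h1]
    | succ n ih =>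
      rw [pow_succ, ih, h3, totalSpin_two]
      have : (c : ℂ) • (U * (Matrix.diagonal fun x => ((dsum N x : ℝ) : ℂ)) * V)
          = U * (Matrix.diagonal fun x => ((c * dsum N x : ℝ) : ℂ)) * V := by
        rw [← Matrix.smul_mul, ← Matrix.mul_smul, ← Matrix.diagonal_smul]
        congr 3
        funext x
        simp
      rw [this]
      calc _ = U * (Matrix.diagonal fun x => (((c * dsum N x) ^ n : ℝ) : ℂ)) * (V * U) *
            (Matrix.diagonal fun x => ((c * dsum N x : ℝ) : ℂ)) * V := by
            simp only [Matrix.mul_assoc]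
        _ = _ := by
            rw [h2, Matrix.mul_one, Matrix.mul_assoc U, Matrix.diagonal_mul_diagonal]
            simp only [pow_succ, Complex.ofReal_mul]
  induction f using Polynomial.induction_on' with
  | add f g hf hg =>
    simp only [map_add, Matrix.trace_add, hf, hg, Polynomial.eval_add, Finset.sum_add_distrib,
      Complex.ofReal_add]
  | monomial n a =>
    rw [Polynomial.aeval_monomial, hpow, ← Algebra.smul_def, Matrix.trace_smul,
      Matrix.trace_mul_comm, ← Matrix.mul_assoc, h2, Matrix.one_mul, Matrix.trace_diagonal]
    simp [Finset.mul_sum]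

/-- for every `α ∈ {x,y,z}` and every real polynomial `f`,
`lim_{N→∞} 2^{-N} tr f(Ŝ_α^{(N)}/√N) = √(2/π) ∫ f(η) e^{-2η²} dη`. -/
theorem tendsto_trace_poly_totalSpin (α : Fin 3) (f : Polynomial ℝ) :
    Tendsto (fun N : ℕ =>
        (Polynomial.aeval (((Real.sqrt N : ℂ))⁻¹ • totalSpin N α) f).trace / 2 ^ N)
      atTop
      (𝓝 ((Real.sqrt (2 / Real.pi) *
        ∫ η : ℝ, f.eval η * Real.exp (-2 * η ^ 2) : ℝ) : ℂ)) := by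
  have h := (Complex.continuous_ofReal.tendsto _).comp (real_lim f)
  refine h.congr fun N => ?_
  have := trace_formula N α (Real.sqrt N)⁻¹ f
  rw [Complex.ofReal_inv] at this
  rw [this]
  simp
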